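/- arXiv:1611.09744 — 4 statements merged into one kernel-verified Lean document; each statement's English description precedes it below -/
import Mathlib

section
/- There exist absolute constants C0 > 0 and C1 > 0 such that for every d ≥ 6 and every σ > 0 the following holds: any estimator T̂ (measurable function of y) satisfying sup_{θ ∈ Θ_s} E_θ[(T̂(y) − L(θ))²] ≤ C0·Φ^L(σ,s) for some integer s with d^{1/4} ≤ s ≤ d, must satisfy sup_{θ ∈ Θ_1} E_θ[(T̂(y) − L(θ))²] ≥ C1 σ² d^{1/4}. -/
open MeasureTheory ProbabilityTheory

/-- Law of `y = θ + σ·ξ` with `ξ` i.i.d. standard normal: the product of Gaussians `N(θ j, σ²)`. -/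
noncomputable def gaussMeasure (d : ℕ) (θ : Fin d → ℝ) (σ : ℝ) : Measure (Fin d → ℝ) :=
  Measure.pi fun j => gaussianReal (θ j) (Real.toNNReal (σ ^ 2))

/-- The sparsity class `Θ_s`: vectors with at most `s` nonzero coordinates. -/
def Theta (d s : ℕ) : Set (Fin d → ℝ) := {θ | {j | θ j ≠ 0}.ncard ≤ s}

/-- The linear functional `L(θ) = ∑ θ_j`. -/
noncomputable def Lfun (d : ℕ) (θ : Fin d → ℝ) : ℝ := ∑ j, θ j

/-- The rate `Φ^L(σ, s) = σ² s² log(1 + d (log d) / s²)`. -/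
noncomputable def PhiL (d : ℕ) (σ : ℝ) (s : ℕ) : ℝ :=
  σ ^ 2 * (s : ℝ) ^ 2 * Real.log (1 + (d : ℝ) * Real.log d / (s : ℝ) ^ 2)


/-- Likelihood ratio of `P_θ` with respect to `P_0`. -/
noncomputable def lrat (d : ℕ) (σ : ℝ) (θ y : Fin d → ℝ) : ℝ :=
  ∏ j, Real.exp (θ j * y j / σ ^ 2 - θ j ^ 2 / (2 * σ ^ 2))

lemma lrat_nonneg (d : ℕ) (σ : ℝ) (θ y : Fin d → ℝ) : 0 ≤ lrat d σ θ y :=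
  Finset.prod_nonneg fun _ _ => (Real.exp_pos _).le

lemma measurable_lrat (d : ℕ) (σ : ℝ) (θ : Fin d → ℝ) : Measurable (lrat d σ θ) := by
  unfold lrat
  fun_prop

lemma gaussianReal_density (σ : ℝ) (hσ : 0 < σ) (μ : ℝ) :
    gaussianReal μ (Real.toNNReal (σ ^ 2)) =
      (gaussianReal 0 (Real.toNNReal (σ ^ 2))).withDensity
        (fun y => ENNReal.ofReal (Real.exp (μ * y / σ ^ 2 - μ ^ 2 / (2 * σ ^ 2)))) := by
  have hv : Real.toNNReal (σ ^ 2) ≠ 0 := by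
    have : 0 < σ ^ 2 := by positivity
    exact (Real.toNNReal_pos.2 this).ne'
  rw [gaussianReal_of_var_ne_zero _ hv, gaussianReal_of_var_ne_zero _ hv,
    ← withDensity_mul _ (measurable_gaussianPDF _ _) (by fun_prop)]
  congr 1
  ext y
  simp only [Pi.mul_apply, gaussianPDF]
  rw [← ENNReal.ofReal_mul (gaussianPDFReal_nonneg _ _ _)]
  congr 1
  simp only [gaussianPDFReal]
  rw [mul_assoc (√_)⁻¹, ← Real.exp_add, Real.coe_toNNReal _ (by positivity)]
  congr 2
  field_simp
  ring

lemma gauss_density (d : ℕ) (σ : ℝ) (hσ : 0 < σ) (θ : Fin d → ℝ) :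
    gaussMeasure d θ σ =
      (gaussMeasure d 0 σ).withDensity (fun y => ENNReal.ofReal (lrat d σ θ y)) := by
  unfold gaussMeasure
  apply Measure.pi_eq
  intro s hs
  rw [withDensity_apply _ (MeasurableSet.univ_pi hs),
    ← lintegral_indicator (MeasurableSet.univ_pi hs)]
  set f : Fin d → ℝ → ENNReal := fun j => (s j).indicator
    (fun y => ENNReal.ofReal (Real.exp (θ j * y / σ ^ 2 - θ j ^ 2 / (2 * σ ^ 2)))) with hf
  have hfm : ∀ j, Measurable (f j) := fun j => Measurable.indicator (by fun_prop) (hs j)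
  have h1 : (Set.univ.pi s).indicator (fun y => ENNReal.ofReal (lrat d σ θ y)) =
      fun y => ∏ j, f j (y j) := by
    ext y
    by_cases hy : y ∈ Set.univ.pi s
    · rw [Set.indicator_of_mem hy, lrat, ENNReal.ofReal_prod_of_nonneg
        (fun _ _ => (Real.exp_pos _).le)]
      refine Finset.prod_congr rfl fun j _ => ?_
      rw [hf]
      simp only
      rw [Set.indicator_of_mem (hy j (Set.mem_univ _))]
    · rw [Set.indicator_of_notMem hy]
      simp only [Set.mem_pi, Set.mem_univ, true_imp_iff, not_forall] at hy
      obtain ⟨j, hj⟩ := hy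
      symm
      apply Finset.prod_eq_zero (Finset.mem_univ j)
      rw [hf]
      simp only
      rw [Set.indicator_of_notMem hj]
  rw [h1]
  have hind := iIndepFun_pi (μ := fun j : Fin d => gaussianReal ((0 : Fin d → ℝ) j)
    (Real.toNNReal (σ ^ 2))) (X := f) (fun j => (hfm j).aemeasurable)
  refine (lintegral_prod_eq_prod_lintegral_of_indepFun Finset.univ
    (fun (j : Fin d) (y : Fin d → ℝ) => f j (y j)) hind
    (fun j => (hfm j).comp (measurable_pi_apply j))).trans ?_
  refine Finset.prod_congr rfl fun j _ => ?_
  rw [gaussianReal_density σ hσ (θ j), withDensity_apply _ (hs j),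
    ← lintegral_indicator (hs j)]
  exact (measurePreserving_eval (fun j : Fin d => gaussianReal ((0 : Fin d → ℝ) j)
    (Real.toNNReal (σ ^ 2))) j).lintegral_comp (hfm j)

lemma lintegral_gauss (d : ℕ) (σ : ℝ) (hσ : 0 < σ) (θ : Fin d → ℝ) (g : (Fin d → ℝ) → ENNReal)
    (hg : Measurable g) :
    ∫⁻ y, g y ∂(gaussMeasure d θ σ) =
      ∫⁻ y, ENNReal.ofReal (lrat d σ θ y) * g y ∂(gaussMeasure d 0 σ) := by
  rw [gauss_density d σ hσ θ, lintegral_withDensity_eq_lintegral_mul _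
    (measurable_lrat d σ θ).ennreal_ofReal hg]
  rfl

instance gaussMeasure_prob (d : ℕ) (σ : ℝ) (θ : Fin d → ℝ) :
    IsProbabilityMeasure (gaussMeasure d θ σ) := by
  unfold gaussMeasure; infer_instance

lemma lintegral_lrat (d : ℕ) (σ : ℝ) (hσ : 0 < σ) (θ : Fin d → ℝ) :
    ∫⁻ y, ENNReal.ofReal (lrat d σ θ y) ∂(gaussMeasure d 0 σ) = 1 := by
  have := lintegral_gauss d σ hσ θ (fun _ => 1) measurable_const
  simpa using this.symm

lemma lrat_mul (d : ℕ) (σ : ℝ) (hσ : 0 < σ) (θ θ' y : Fin d → ℝ) :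
    lrat d σ θ y * lrat d σ θ' y =
      (∏ j, Real.exp (θ j * θ' j / σ ^ 2)) * lrat d σ (θ + θ') y := by
  unfold lrat
  rw [← Finset.prod_mul_distrib, ← Finset.prod_mul_distrib]
  refine Finset.prod_congr rfl fun j _ => ?_
  rw [← Real.exp_add, ← Real.exp_add]
  congr 1
  simp only [Pi.add_apply]
  field_simp
  ring

lemma lintegral_lrat_mul (d : ℕ) (σ : ℝ) (hσ : 0 < σ) (θ θ' : Fin d → ℝ) :
    ∫⁻ y, ENNReal.ofReal (lrat d σ θ y * lrat d σ θ' y) ∂(gaussMeasure d 0 σ) =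
      ENNReal.ofReal (∏ j, Real.exp (θ j * θ' j / σ ^ 2)) := by
  have h0 : 0 ≤ ∏ j, Real.exp (θ j * θ' j / σ ^ 2) :=
    Finset.prod_nonneg fun _ _ => (Real.exp_pos _).le
  simp_rw [lrat_mul d σ hσ, ENNReal.ofReal_mul h0]
  rw [lintegral_const_mul _ (measurable_lrat d σ _).ennreal_ofReal, lintegral_lrat d σ hσ, mul_one]

/-- General Bayesian two-point inequality. -/
lemma key_ineq (d : ℕ) (σ : ℝ) (hσ : 0 < σ) (T : (Fin d → ℝ) → ℝ) (hT : Measurable T)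
    {ι : Type*} [Fintype ι] [Nonempty ι] (θ : ι → Fin d → ℝ) (l M R R0 : ℝ)
    (hM : 0 < M) (hR : 0 ≤ R) (hR0 : 0 ≤ R0)
    (hM2 : ∑ f, ∑ g, ∏ j, Real.exp (θ f j * θ g j / σ ^ 2) ≤ (Fintype.card ι : ℝ) ^ 2 * M)
    (h0 : ∫⁻ y, ENNReal.ofReal (T y ^ 2) ∂(gaussMeasure d 0 σ) ≤ ENNReal.ofReal R0)
    (h1 : ∀ f, ∫⁻ y, ENNReal.ofReal ((T y - l) ^ 2) ∂(gaussMeasure d (θ f) σ)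
      ≤ ENNReal.ofReal R) :
    l ^ 2 ≤ 2 * R + 4 * M * R0 := by
  set N : ℝ := (Fintype.card ι : ℝ) with hN
  have hNpos : 0 < N := by rw [hN]; exact_mod_cast Fintype.card_pos
  -- unnormalised mixture
  have hpt : ∀ y, l ^ 2 * ∑ f, lrat d σ (θ f) y ≤
      ∑ f, lrat d σ (θ f) y * (T y - l) ^ 2 + (2 * M * N) * T y ^ 2 +
        l ^ 2 / (2 * M * N) * ∑ f, ∑ g, lrat d σ (θ f) y * lrat d σ (θ g) y := by
    intro y
    rw [← Finset.sum_mul, ← Finset.sum_mul_sum]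
    set L := ∑ f, lrat d σ (θ f) y
    have hL : 0 ≤ L := Finset.sum_nonneg fun f _ => lrat_nonneg _ _ _ _
    set K := 2 * M * N
    have hK : 0 < K := by positivity
    set t := T y
    have key : 0 ≤ ((L + K) * t - L * l) ^ 2 + l ^ 2 * L ^ 3 / K := by positivity
    have e : (L + K) * (L * (t - l) ^ 2 + K * t ^ 2 + l ^ 2 / K * (L * L) - l ^ 2 * L)
        = ((L + K) * t - L * l) ^ 2 + l ^ 2 * L ^ 3 / K := by
      field_simp
      ring
    rw [← e] at key
    have := nonneg_of_mul_nonneg_right key (by positivity : 0 < L + K)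
    linarith
  have hm := fun f => measurable_lrat d σ (θ f)
  have hI := lintegral_mono (μ := gaussMeasure d 0 σ) (fun y => ENNReal.ofReal_le_ofReal (hpt y))
  have hA : ∫⁻ y, ENNReal.ofReal (l ^ 2 * ∑ f, lrat d σ (θ f) y) ∂(gaussMeasure d 0 σ)
      = ENNReal.ofReal (l ^ 2 * N) := by
    simp_rw [ENNReal.ofReal_mul (sq_nonneg l),
      ENNReal.ofReal_sum_of_nonneg (fun f _ => lrat_nonneg d σ (θ f) _)]
    rw [lintegral_const_mul _ (by fun_prop), lintegral_finsetSum _ (by fun_prop)]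
    simp_rw [lintegral_lrat d σ hσ]
    simp [hN]
  have hB : ∫⁻ y, ENNReal.ofReal (∑ f, lrat d σ (θ f) y * (T y - l) ^ 2) ∂(gaussMeasure d 0 σ)
      ≤ ENNReal.ofReal (N * R) := by
    simp_rw [ENNReal.ofReal_sum_of_nonneg (fun f _ => mul_nonneg (lrat_nonneg d σ (θ f) _)
      (sq_nonneg _)), ENNReal.ofReal_mul (lrat_nonneg d σ _ _)]
    rw [lintegral_finsetSum _ (by fun_prop)]
    calc _ ≤ ∑ f : ι, ENNReal.ofReal R := by
          refine Finset.sum_le_sum fun f _ => ?_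
          rw [← lintegral_gauss d σ hσ (θ f) (fun y => ENNReal.ofReal ((T y - l) ^ 2))
            (by fun_prop)]
          exact h1 f
      _ = _ := by
          rw [ENNReal.ofReal_mul hNpos.le]
          simp [hN]
  have hC : ∫⁻ y, ENNReal.ofReal ((2 * M * N) * T y ^ 2) ∂(gaussMeasure d 0 σ)
      ≤ ENNReal.ofReal (2 * M * N * R0) := by
    have : 0 ≤ 2 * M * N := by positivity
    simp_rw [ENNReal.ofReal_mul this]
    rw [lintegral_const_mul _ (by fun_prop)]
    gcongr
  have hD : ∫⁻ y, ENNReal.ofReal (l ^ 2 / (2 * M * N) *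
      ∑ f, ∑ g, lrat d σ (θ f) y * lrat d σ (θ g) y) ∂(gaussMeasure d 0 σ)
      ≤ ENNReal.ofReal (l ^ 2 * N / 2) := by
    have h2 : 0 ≤ l ^ 2 / (2 * M * N) := by positivity
    have h3 : ∀ f g y, 0 ≤ lrat d σ (θ f) y * lrat d σ (θ g) y := fun f g y =>
      mul_nonneg (lrat_nonneg _ _ _ _) (lrat_nonneg _ _ _ _)
    simp_rw [ENNReal.ofReal_mul h2,
      ENNReal.ofReal_sum_of_nonneg (fun f _ => Finset.sum_nonneg fun g _ => h3 f g _),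
      ENNReal.ofReal_sum_of_nonneg (fun g _ => h3 _ g _)]
    rw [lintegral_const_mul _ (by fun_prop), lintegral_finsetSum _ (by fun_prop)]
    have h4 : ∀ f, ∫⁻ y, ∑ g, ENNReal.ofReal (lrat d σ (θ f) y * lrat d σ (θ g) y)
        ∂(gaussMeasure d 0 σ) = ENNReal.ofReal (∑ g, ∏ j, Real.exp (θ f j * θ g j / σ ^ 2)) := by
      intro f
      rw [lintegral_finsetSum _ (by fun_prop), ENNReal.ofReal_sum_of_nonneg
        (fun g _ => Finset.prod_nonneg fun _ _ => (Real.exp_pos _).le)]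
      simp_rw [lintegral_lrat_mul d σ hσ]
    simp_rw [h4]
    rw [← ENNReal.ofReal_sum_of_nonneg (fun f _ => Finset.sum_nonneg
      (fun g _ => Finset.prod_nonneg fun _ _ => (Real.exp_pos _).le)), ← ENNReal.ofReal_mul h2]
    apply ENNReal.ofReal_le_ofReal
    calc _ ≤ l ^ 2 / (2 * M * N) * (N ^ 2 * M) := by gcongr
      _ = _ := by field_simp
  have hfin : ENNReal.ofReal (l ^ 2 * N) ≤
      ENNReal.ofReal (N * R + 2 * M * N * R0 + l ^ 2 * N / 2) := by
    rw [← hA]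
    refine hI.trans ?_
    rw [ENNReal.ofReal_add (by positivity) (by positivity),
      ENNReal.ofReal_add (by positivity) (by positivity)]
    refine le_trans ?_ (add_le_add (add_le_add hB hC) hD)
    rw [← lintegral_add_left (by fun_prop), ← lintegral_add_left (by fun_prop)]
    refine lintegral_mono fun y => ?_
    exact ENNReal.ofReal_add_le.trans (add_le_add_left ENNReal.ofReal_add_le _)
  rw [ENNReal.ofReal_le_ofReal_iff (by positivity)] at hfin
  have : N * l ^ 2 ≤ N * (2 * R + 4 * M * R0) := by nlinarith
  exact le_of_mul_le_mul_left this hNpos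

/-- The block prior support points. -/
noncomputable def thetaF {d s m : ℕ} (e : Fin s × Fin m ↪ Fin d) (a : ℝ) (f : Fin s → Fin m) :
    Fin d → ℝ := fun j => ∑ i, if e (i, f i) = j then a else 0

lemma thetaF_mem {d s m : ℕ} (e : Fin s × Fin m ↪ Fin d) (a : ℝ) (f : Fin s → Fin m) :
    thetaF e a f ∈ Theta d s := by
  have hsub : {j | thetaF e a f j ≠ 0} ⊆ Set.range (fun i => e (i, f i)) := by
    intro j hj
    by_contra hc
    apply hj
    refine Finset.sum_eq_zero fun i _ => ?_
    rw [if_neg]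
    exact fun h => hc ⟨i, h⟩
  show Set.ncard _ ≤ s
  refine (Set.ncard_le_ncard hsub (Set.toFinite _)).trans ?_
  rw [← Set.image_univ]
  refine (Set.ncard_image_le (Set.toFinite _)).trans ?_
  simp [Set.ncard_univ]

lemma Lfun_thetaF {d s m : ℕ} (e : Fin s × Fin m ↪ Fin d) (a : ℝ) (f : Fin s → Fin m) :
    Lfun d (thetaF e a f) = s * a := by
  unfold Lfun thetaF
  rw [Finset.sum_comm]
  simp

lemma thetaF_inner {d s m : ℕ} (e : Fin s × Fin m ↪ Fin d) (a : ℝ) (f g : Fin s → Fin m) :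
    ∑ j, thetaF e a f j * thetaF e a g j = ∑ i, if g i = f i then a ^ 2 else 0 := by
  have h1 : ∀ i, thetaF e a g (e (i, f i)) = if g i = f i then a else 0 := by
    intro i
    unfold thetaF
    rw [Finset.sum_eq_single i]
    · simp
    · intro k _ hk
      rw [if_neg]
      intro h
      have := e.injective h
      simp only [Prod.mk.injEq] at this
      exact hk this.1
    · simp
  calc _ = ∑ j, ∑ i, (if e (i, f i) = j then a * thetaF e a g j else 0) := by
        refine Finset.sum_congr rfl fun j _ => ?_
        conv_lhs => rw [thetaF]
        rw [Finset.sum_mul]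
        refine Finset.sum_congr rfl fun i _ => ?_
        split_ifs <;> simp
    _ = _ := by
        rw [Finset.sum_comm]
        refine Finset.sum_congr rfl fun i _ => ?_
        rw [Finset.sum_ite_eq]
        simp only [Finset.mem_univ, if_true, h1]
        split_ifs
        · ring
        · simp

lemma second_moment {d s m : ℕ} (e : Fin s × Fin m ↪ Fin d) (σ b : ℝ) (hσ : 0 < σ) :
    ∑ f, ∑ g, ∏ j, Real.exp (thetaF e (σ * b) f j * thetaF e (σ * b) g j / σ ^ 2) =
      (m : ℝ) ^ s * (m - 1 + Real.exp (b ^ 2)) ^ s := by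
  have h1 : ∀ f g, ∏ j, Real.exp (thetaF e (σ * b) f j * thetaF e (σ * b) g j / σ ^ 2) =
      ∏ i, (if g i = f i then Real.exp (b ^ 2) else 1) := by
    intro f g
    rw [← Real.exp_sum, ← Finset.sum_div, thetaF_inner, Finset.sum_div, Real.exp_sum]
    refine Finset.prod_congr rfl fun i _ => ?_
    split_ifs
    · congr 1
      field_simp
    · simp
  have h2 : ∀ f : Fin s → Fin m, ∑ g : Fin s → Fin m,
      ∏ i, (if g i = f i then Real.exp (b ^ 2) else 1) = (m - 1 + Real.exp (b ^ 2)) ^ s := by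
    intro f
    rw [← Fintype.prod_sum (fun i k => if k = f i then Real.exp (b ^ 2) else 1)]
    have h3 : ∀ i, ∑ k, (if k = f i then Real.exp (b ^ 2) else 1) = m - 1 + Real.exp (b ^ 2) := by
      intro i
      have : ∀ k, (if k = f i then Real.exp (b ^ 2) else 1) =
          1 + (if k = f i then Real.exp (b ^ 2) - 1 else 0) := by
        intro k
        split_ifs <;> ring
      simp_rw [this]
      rw [Finset.sum_add_distrib, Finset.sum_ite_eq']
      simp
      ring
    simp_rw [h3]
    simp
  simp_rw [h1, h2]
  simp

lemma moment_bound {d s : ℕ} (hs : 1 ≤ s) (hsd : s ≤ d) (b : ℝ) :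
    ((d / s : ℕ) : ℝ) ^ s * ((d / s : ℕ) - 1 + Real.exp (b ^ 2)) ^ s ≤
      (((d / s : ℕ) : ℝ) ^ s) ^ 2 * Real.exp (2 * s ^ 2 / d * (Real.exp (b ^ 2) - 1)) := by
  set m := d / s with hm
  have hm1 : 1 ≤ m := Nat.div_pos hsd hs
  have hdm : d ≤ 2 * (s * m) := by
    have h := Nat.lt_mul_div_succ d hs
    have : s ≤ s * m := Nat.le_mul_of_pos_right _ hm1
    rw [← hm, mul_add, mul_one] at h
    omega
  have hdm' : (d : ℝ) ≤ 2 * (s * m) := by exact_mod_cast hdm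
  have hmR : (0 : ℝ) < m := by exact_mod_cast hm1
  have hsR : (0 : ℝ) < s := by exact_mod_cast hs
  have hdR : (0 : ℝ) < d := by exact_mod_cast (lt_of_lt_of_le hs hsd)
  have hx : 0 ≤ Real.exp (b ^ 2) - 1 := by
    have := Real.add_one_le_exp (b ^ 2)
    nlinarith [sq_nonneg b]
  set x := Real.exp (b ^ 2) - 1
  have e1 : (m : ℝ) - 1 + Real.exp (b ^ 2) = m * (1 + x / m) := by
    field_simp
    simp only [x]
    ring
  rw [e1, mul_pow, sq, mul_assoc]
  have h2 : (1 + x / m) ^ s ≤ Real.exp (2 * s ^ 2 / d * x) := by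
    calc (1 + x / m) ^ s ≤ (Real.exp (x / m)) ^ s := by
          gcongr
          linarith [Real.add_one_le_exp (x / m)]
      _ = Real.exp (s * (x / m)) := by rw [Real.exp_nat_mul]
      _ ≤ _ := by
          apply Real.exp_le_exp.2
          have : (s : ℝ) / m ≤ 2 * s ^ 2 / d := by
            rw [div_le_div_iff₀ hmR hdR]
            nlinarith
          calc (s : ℝ) * (x / m) = s / m * x := by ring
            _ ≤ _ := by gcongr
  gcongr

set_option maxHeartbeats 1000000 in
/-- Theorem 2: any estimator whose maximal risk over some `Θ_s` with `s ≥ d^{1/4}` is smaller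
than `C₀ Φ^L(σ, s)` has a degenerate maximal risk (at least `C₁ σ² d^{1/4}`) over `Θ₁`. -/
theorem lower_bound_adaptation :
    ∃ C0 : ℝ, 0 < C0 ∧ ∃ C1 : ℝ, 0 < C1 ∧
      ∀ d : ℕ, 6 ≤ d → ∀ σ : ℝ, 0 < σ → ∀ T : (Fin d → ℝ) → ℝ, Measurable T →
        (∃ s : ℕ, (d : ℝ) ^ (1 / 4 : ℝ) ≤ (s : ℝ) ∧ s ≤ d ∧
          ∀ θ ∈ Theta d s,
            ∫⁻ y, ENNReal.ofReal ((T y - Lfun d θ) ^ 2) ∂(gaussMeasure d θ σ)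
              ≤ ENNReal.ofReal (C0 * PhiL d σ s)) →
        ENNReal.ofReal (C1 * σ ^ 2 * (d : ℝ) ^ (1 / 4 : ℝ)) ≤
          ⨆ θ ∈ Theta d 1,
            ∫⁻ y, ENNReal.ofReal ((T y - Lfun d θ) ^ 2) ∂(gaussMeasure d θ σ) := by
  refine ⟨1 / 32, by norm_num, 1 / 256, by norm_num, ?_⟩
  intro d hd σ hσ T hT ⟨s, hs1, hsd, hrisk⟩
  have hzero : (0 : Fin d → ℝ) ∈ Theta d 1 := by simp [Theta]
  refine le_trans ?_ (le_iSup₂ (f := fun θ (_ : θ ∈ Theta d 1) =>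
    ∫⁻ y, ENNReal.ofReal ((T y - Lfun d θ) ^ 2) ∂(gaussMeasure d θ σ)) 0 hzero)
  have hL0 : Lfun d 0 = 0 := by simp [Lfun]
  simp only [hL0, sub_zero]
  by_contra! hlt
  have hd6 : (6 : ℝ) ≤ d := by exact_mod_cast hd
  have hdR : (0 : ℝ) < d := by linarith
  have hlog : 1 ≤ Real.log d := by
    rw [Real.le_log_iff_exp_le hdR]
    linarith [Real.exp_one_lt_d9]
  set D : ℝ := (d : ℝ) ^ (1 / 4 : ℝ) with hD
  have hD4 : D ^ 4 = d := by
    rw [hD, ← Real.rpow_natCast, ← Real.rpow_mul hdR.le]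
    norm_num
  have hD1 : 1 ≤ D := Real.one_le_rpow (by linarith) (by norm_num)
  have hDexp : D = Real.exp (Real.log d / 4) := by
    rw [hD, Real.rpow_def_of_pos hdR]
    congr 1
    ring
  have hsR : (1 : ℝ) ≤ s := hD1.trans hs1
  have hs : 1 ≤ s := by exact_mod_cast hsR
  have hs0 : (0 : ℝ) < s := by linarith
  have hm1 : 1 ≤ d / s := Nat.div_pos hsd hs
  -- the signal level
  set u : ℝ := d * Real.log d / (s : ℝ) ^ 2 with hu
  have hu0 : 0 < u := by positivity
  set w : ℝ := Real.log (1 + u / 8) with hw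
  have hw0 : 0 ≤ w := Real.log_nonneg (by linarith)
  set b : ℝ := Real.sqrt w with hb
  have hb2 : b ^ 2 = w := Real.sq_sqrt hw0
  have hexp : Real.exp (b ^ 2) = 1 + u / 8 := by
    rw [hb2, hw, Real.exp_log (by linarith)]
  obtain ⟨e⟩ : Nonempty (Fin s × Fin (d / s) ↪ Fin d) := by
    apply Function.Embedding.nonempty_of_card_le
    simpa using Nat.mul_div_le d s
  have : Nonempty (Fin (d / s)) := ⟨⟨0, hm1⟩⟩
  have hM2 := (second_moment e σ b hσ).le.trans (moment_bound hs hsd b)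
  have hMD : Real.exp (2 * (s : ℝ) ^ 2 / d * (Real.exp (b ^ 2) - 1)) = D := by
    rw [hDexp, hexp, hu]
    congr 1
    field_simp
    ring
  rw [hMD] at hM2
  have hPhi : PhiL d σ s = σ ^ 2 * (s : ℝ) ^ 2 * Real.log (1 + u) := rfl
  have hlogu : 0 ≤ Real.log (1 + u) := Real.log_nonneg (by linarith)
  have hkey := key_ineq d σ hσ T hT (thetaF e (σ * b)) (s * (σ * b)) D
    (1 / 32 * PhiL d σ s) (1 / 256 * σ ^ 2 * D) (by linarith) (by rw [hPhi]; positivity)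
    (by positivity) (by simpa using hM2) hlt.le
    (fun f => by
      have := hrisk _ (thetaF_mem e (σ * b) f)
      rwa [Lfun_thetaF] at this)
  -- compare logs
  have hcomp : Real.log (1 + u) ≤ 8 * w := by
    have : (1 + u) ≤ (1 + u / 8) ^ 8 := by
      have := one_add_mul_le_pow (a := u / 8) (by linarith) 8
      push_cast at this
      linarith
    calc Real.log (1 + u) ≤ Real.log ((1 + u / 8) ^ 8) := Real.log_le_log (by linarith) this
      _ = 8 * w := by rw [Real.log_pow]; norm_num [hw]
  -- lower bound of the signal
  have hwlow : D ^ 2 / 16 < s ^ 2 * w := by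
    have h1 : 1 - (1 + u / 8)⁻¹ ≤ w := Real.one_sub_inv_le_log_of_pos (by linarith)
    have hsq : D ^ 2 ≤ (s : ℝ) ^ 2 := by gcongr
    have hD2 : 1 ≤ D ^ 2 := one_le_pow₀ hD1
    set A : ℝ := d * Real.log d with hA
    have hAd : (d : ℝ) ≤ A := by nlinarith
    have hAD : D ^ 2 < A := by nlinarith
    have hA0 : 0 < A := by positivity
    have h2 : 1 - (1 + u / 8)⁻¹ = A / (8 * s ^ 2 + A) := by
      rw [hu]
      field_simp
      ring
    rw [h2] at h1
    have h3 : D ^ 2 / 16 < s ^ 2 * (A / (8 * s ^ 2 + A)) := by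
      rw [← mul_div_assoc, div_lt_div_iff₀ (by norm_num) (by positivity)]
      nlinarith [mul_le_mul_of_nonneg_right hsq hA0.le,
        mul_lt_mul_of_pos_right hAD (by positivity : (0 : ℝ) < s ^ 2)]
    exact h3.trans_le (by gcongr)
  rw [hPhi] at hkey
  have e1 : (s * (σ * b)) ^ 2 = σ ^ 2 * (s ^ 2 * w) := by rw [← hb2]; ring
  rw [e1] at hkey
  have hσ2 : 0 < σ ^ 2 := by positivity
  have e2 : σ ^ 2 * (s ^ 2 * w) ≤
      σ ^ 2 * (s ^ 2 * Real.log (1 + u) / 16 + D ^ 2 / 64) := by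
    linarith
  have e3 := le_of_mul_le_mul_left e2 hσ2
  have e4 : (s : ℝ) ^ 2 * Real.log (1 + u) ≤ s ^ 2 * (8 * w) := by gcongr
  linarith [sq_nonneg D]
end

section
/- There exists an absolute constant d0 ≥ 3 such that for all integers d ≥ d0, all σ > 0 and all integers s with 1 ≤ s < d/2: inf_{θ ∈ Θ_s} P_θ( σ ≤ σ̂ ≤ 10σ ) ≥ 1 − d^{-5}. -/
open MeasureTheory ProbabilityTheory

/-- The variance estimator `σ̂ = 9 (⌊d/2⌋⁻¹ ∑_{j ≤ d/2} y_(j)²)^{1/2}`, where the sum of the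
`⌊d/2⌋` smallest among `y_1², …, y_d²` is expressed as the minimum over all subsets `G` of
cardinality `⌊d/2⌋` of `∑_{i ∈ G} y_i²`. -/
noncomputable def sigmahat (d : ℕ) (y : Fin d → ℝ) : ℝ :=
  9 * Real.sqrt (((d / 2 : ℕ) : ℝ)⁻¹ *
    sInf {x : ℝ | ∃ G : Finset (Fin d), G.card = d / 2 ∧ x = ∑ i ∈ G, (y i) ^ 2})

lemma lint_gauss (μ : ℝ) (v : NNReal) (hv : v ≠ 0) (b : ℝ) (hb : 0 < b) (f : ℝ → ℝ)
    (hf : Measurable f)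
    (h : ∀ x, Real.exp (-(x - μ) ^ 2 / (2 * v)) * f x ≤ Real.exp (-b * x ^ 2)) :
    ∫⁻ x, ENNReal.ofReal (f x) ∂(gaussianReal μ v) ≤ ENNReal.ofReal (√(1 / (2 * v * b))) := by
  have hv' : (0 : ℝ) < v := by positivity
  rw [gaussianReal_of_var_ne_zero _ hv,
    lintegral_withDensity_eq_lintegral_mul _ (measurable_gaussianPDF μ v) hf.ennreal_ofReal]
  have hI := (integrable_exp_neg_mul_sq hb).const_mul (√(2 * Real.pi * v))⁻¹
  calc _ ≤ ∫⁻ x : ℝ, ENNReal.ofReal ((√(2 * Real.pi * v))⁻¹ * Real.exp (-b * x ^ 2)) := by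
        apply lintegral_mono
        intro x
        simp only [Pi.mul_apply, gaussianPDF]
        rw [← ENNReal.ofReal_mul (gaussianPDFReal_nonneg _ _ _)]
        apply ENNReal.ofReal_le_ofReal
        rw [gaussianPDFReal, mul_assoc]
        exact mul_le_mul_of_nonneg_left (h x) (by positivity)
    _ = ENNReal.ofReal (∫ x : ℝ, (√(2 * Real.pi * v))⁻¹ * Real.exp (-b * x ^ 2)) :=
        (ofReal_integral_eq_lintegral_ofReal hI (ae_of_all _ fun x => by positivity)).symm
    _ ≤ _ := by
        rw [integral_const_mul, integral_gaussian, ← Real.sqrt_inv, ← Real.sqrt_mul (by positivity)]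
        apply le_of_eq
        congr 2
        have := Real.pi_pos
        field_simp

lemma chernoff {d : ℕ} (ν : Fin d → Measure ℝ) [∀ i, IsProbabilityMeasure (ν i)]
    (h : ℝ → ℝ) (hh : Measurable h) (G : Finset (Fin d)) (K T : ℝ) (hK : 0 ≤ K)
    (hb : ∀ i ∈ G, ∫⁻ x, ENNReal.ofReal (Real.exp (h x)) ∂(ν i) ≤ ENNReal.ofReal K) :
    Measure.pi ν {y | T ≤ ∑ i ∈ G, h (y i)} ≤ ENNReal.ofReal (Real.exp (-T) * K ^ G.card) := by
  classical
  set g : Fin d → ℝ → ENNReal := fun i x => if i ∈ G then ENNReal.ofReal (Real.exp (h x)) else 1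
    with hg
  have hgm : ∀ i, Measurable (g i) := by
    intro i
    by_cases hi : i ∈ G
    · simp only [hg, hi, if_true]; fun_prop
    · simp only [hg, hi, if_false]; fun_prop
  have hprod : ∀ y : Fin d → ℝ, ∏ i, g i (y i) = ENNReal.ofReal (Real.exp (∑ i ∈ G, h (y i))) := by
    intro y
    rw [Real.exp_sum, ENNReal.ofReal_prod_of_nonneg (fun _ _ => (Real.exp_pos _).le)]
    simp only [hg]
    rw [Finset.prod_ite_mem, Finset.univ_inter]
  have hint : ∫⁻ y, ∏ i, g i (y i) ∂(Measure.pi ν) ≤ ENNReal.ofReal (K ^ G.card) := by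
    have hind : iIndepFun (fun i (y : Fin d → ℝ) => g i (y i)) (Measure.pi ν) :=
      iIndepFun_pi (fun i => (hgm i).aemeasurable)
    rw [lintegral_prod_eq_prod_lintegral_of_indepFun Finset.univ _ hind
      (fun i => (hgm i).comp (measurable_pi_apply i))]
    have hev : ∀ i, ∫⁻ y, g i (y i) ∂(Measure.pi ν) = ∫⁻ x, g i x ∂(ν i) := fun i =>
      (measurePreserving_eval ν i).lintegral_comp (hgm i)
    simp only [hev]
    calc _ ≤ ∏ i, (if i ∈ G then ENNReal.ofReal K else 1) := by
          apply Finset.prod_le_prod' 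
          intro i _
          by_cases hi : i ∈ G
          · simpa [hg, hi] using hb i hi
          · simp [hg, hi]
      _ = _ := by
          rw [Finset.prod_ite_mem, Finset.univ_inter, Finset.prod_const, ENNReal.ofReal_pow hK]
  have hT : ENNReal.ofReal (Real.exp T) ≠ 0 := by simp [Real.exp_pos]
  have hm := meas_ge_le_lintegral_div (μ := Measure.pi ν) (f := fun y => ∏ i, g i (y i))
    (Finset.measurable_fun_prod _ fun i _ => (hgm i).comp (measurable_pi_apply i)).aemeasurable hT ENNReal.ofReal_ne_top
  refine (measure_mono ?_).trans (hm.trans ?_)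
  · intro y hy
    simp only [Set.mem_setOf_eq] at hy ⊢
    rw [hprod]
    exact ENNReal.ofReal_le_ofReal (Real.exp_le_exp.2 hy)
  · rw [Real.exp_neg, mul_comm, ← div_eq_mul_inv, ENNReal.ofReal_div_of_pos (Real.exp_pos _)]
    gcongr

lemma num1 : 4 * (Real.exp (1 / 2) * (1 / 9)) ≤ (99 / 100 : ℝ) := by
  have h : Real.exp (1 / 2) ^ 2 = Real.exp 1 := by rw [← Real.exp_nat_mul]; norm_num
  have := Real.exp_one_lt_d9
  have : Real.exp (1 / 2) ≤ 2 := by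
    apply le_of_sq_le_sq _ (by norm_num)
    rw [h]; linarith
  linarith

lemma num2 : Real.exp (-(10 / 81)) * √(5 / 4) ≤ (99 / 100 : ℝ) := by
  have h : Real.exp (10 / 81) ^ 2 = Real.exp (20 / 81) := by rw [← Real.exp_nat_mul]; norm_num
  have h2 := Real.quadratic_le_exp_of_nonneg (x := 20 / 81) (by norm_num)
  rw [Real.exp_neg, inv_mul_le_iff₀ (Real.exp_pos _)]
  apply Real.sqrt_le_iff.2 ⟨by positivity, ?_⟩
  rw [mul_pow, h]
  norm_num at h2 ⊢
  linarith

lemma asym : ∃ M : ℕ, ∀ m ≥ M, (m : ℝ) ^ 5 * (99 / 100 : ℝ) ^ m < 1 / 729 := by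
  have := tendsto_pow_const_mul_const_pow_of_abs_lt_one 5 (r := (99 / 100 : ℝ))
    (by rw [abs_of_pos] <;> norm_num)
  exact Filter.eventually_atTop.1 (this.eventually_lt_const (by norm_num))

lemma sigmahat_good {d : ℕ} (hd : 0 < d / 2) (σ : ℝ) (hσ : 0 < σ) (y : Fin d → ℝ)
    (G₀ : Finset (Fin d)) (hG₀ : G₀.card = d / 2)
    (hlow : ∀ G : Finset (Fin d), G.card = d / 2 →
      ((d / 2 : ℕ) : ℝ) * σ ^ 2 / 81 ≤ ∑ i ∈ G, y i ^ 2)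
    (hup : ∑ i ∈ G₀, y i ^ 2 ≤ ((d / 2 : ℕ) : ℝ) * σ ^ 2 * 100 / 81) :
    σ ≤ sigmahat d y ∧ sigmahat d y ≤ 10 * σ := by
  have hm : (0 : ℝ) < ((d / 2 : ℕ) : ℝ) := by exact_mod_cast hd
  unfold sigmahat
  set m : ℝ := ((d / 2 : ℕ) : ℝ)
  set S := {x : ℝ | ∃ G : Finset (Fin d), G.card = d / 2 ∧ x = ∑ i ∈ G, (y i) ^ 2}
  have hmem : ∑ i ∈ G₀, y i ^ 2 ∈ S := ⟨G₀, hG₀, rfl⟩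
  have hlb : ∀ x ∈ S, m * σ ^ 2 / 81 ≤ x := by
    rintro x ⟨G, hG, rfl⟩
    exact hlow G hG
  have h1 : m * σ ^ 2 / 81 ≤ sInf S := le_csInf ⟨_, hmem⟩ hlb
  have h2 : sInf S ≤ m * σ ^ 2 * 100 / 81 := (csInf_le ⟨_, hlb⟩ hmem).trans hup
  constructor
  · have : σ / 9 ≤ √(m⁻¹ * sInf S) := by
      apply Real.le_sqrt_of_sq_le
      rw [le_inv_mul_iff₀ hm]
      linarith
    linarith
  · have : √(m⁻¹ * sInf S) ≤ 10 * σ / 9 := by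
      apply Real.sqrt_le_iff.2 ⟨by positivity, ?_⟩
      rw [inv_mul_le_iff₀ hm]
      linarith
    linarith

theorem sigmahat_concentration :
    ∃ d0 : ℕ, 3 ≤ d0 ∧
      ∀ d : ℕ, d0 ≤ d → ∀ σ : ℝ, 0 < σ → ∀ s : ℕ, 1 ≤ s → (s : ℝ) < (d : ℝ) / 2 →
        ∀ θ ∈ Theta d s,
          ENNReal.ofReal (1 - ((d : ℝ) ^ 5)⁻¹) ≤
            gaussMeasure d θ σ {y | σ ≤ sigmahat d y ∧ sigmahat d y ≤ 10 * σ} := by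
  classical
  obtain ⟨M, hM⟩ := asym
  refine ⟨2 * M + 3, by omega, ?_⟩
  intro d hd σ hσ s hs hsd θ hθ
  obtain ⟨m, hm⟩ : ∃ m, m = d / 2 := ⟨_, rfl⟩
  have hm0 : 0 < m := by omega
  have hmM : M ≤ m := by omega
  have hmR : (0 : ℝ) < m := by exact_mod_cast hm0
  have hsd' : 2 * s < d := by
    have : (2 : ℝ) * s < d := by linarith
    exact_mod_cast this
  -- zero coordinates
  obtain ⟨G₀, hG₀sub, hG₀⟩ : ∃ G₀ ⊆ Finset.univ.filter (fun j => θ j = 0), G₀.card = m := by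
    apply Finset.exists_subset_card_eq
    have h1 : (Finset.univ.filter (fun j => θ j ≠ 0)).card ≤ s := by
      have : {j | θ j ≠ 0}.ncard ≤ s := hθ
      rwa [Set.ncard_eq_toFinset_card', Set.toFinset_setOf] at this
    have h2 := Finset.card_filter_add_card_filter_not (s := (Finset.univ : Finset (Fin d)))
      (fun j => θ j = 0)
    simp only [Finset.card_univ, Fintype.card_fin] at h2
    have h3 : (Finset.univ.filter (fun j => ¬ θ j = 0)).card ≤ s := h1
    omega
  set v : NNReal := Real.toNNReal (σ ^ 2) with hv
  have hvR : (v : ℝ) = σ ^ 2 := Real.coe_toNNReal _ (by positivity)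
  have hv0 : v ≠ 0 := by
    intro h
    rw [h] at hvR
    have : 0 < σ ^ 2 := by positivity
    rw [← hvR] at this
    simp at this
  set P := gaussMeasure d θ σ with hP
  have hPpi : P = Measure.pi fun j => gaussianReal (θ j) v := rfl
  haveI : IsProbabilityMeasure P := by rw [hPpi]; infer_instance
  -- lower tail
  have hlow : ∀ G : Finset (Fin d), G.card = m →
      P {y | -((m : ℝ) / 2) ≤ ∑ i ∈ G, (-(81 / (2 * σ ^ 2)) * (y i) ^ 2)}
        ≤ ENNReal.ofReal ((Real.exp (1 / 2) * (1 / 9)) ^ m) := by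
    intro G hG
    have := chernoff (fun j => gaussianReal (θ j) v) (fun x => -(81 / (2 * σ ^ 2)) * x ^ 2)
      (by fun_prop) G (1 / 9) (-((m : ℝ) / 2)) (by norm_num) (by
        intro i _
        refine (lint_gauss (θ i) v hv0 (81 / (2 * σ ^ 2)) (by positivity) _ (by fun_prop) ?_).trans ?_
        · intro x
          have : Real.exp (-(x - θ i) ^ 2 / (2 * v)) ≤ 1 := by
            rw [Real.exp_le_one_iff]
            apply div_nonpos_of_nonpos_of_nonneg
            · nlinarith [sq_nonneg (x - θ i)]
            · positivity
          exact mul_le_of_le_one_left (Real.exp_pos _).le this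
        · apply ENNReal.ofReal_le_ofReal
          apply Real.sqrt_le_iff.2 ⟨by norm_num, ?_⟩
          rw [hvR]
          apply le_of_eq
          field_simp
          norm_num)
    rw [hG] at this
    rw [hPpi]
    refine this.trans (le_of_eq ?_)
    rw [mul_pow, ← Real.exp_nat_mul]
    congr 3
    ring
  -- upper tail
  have hup : P {y | (m : ℝ) * (10 / 81) ≤ ∑ i ∈ G₀, ((1 / (10 * σ ^ 2)) * (y i) ^ 2)}
        ≤ ENNReal.ofReal ((Real.exp (-(10 / 81)) * √(5 / 4)) ^ m) := by
    have := chernoff (fun j => gaussianReal (θ j) v) (fun x => (1 / (10 * σ ^ 2)) * x ^ 2)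
      (by fun_prop) G₀ (√(5 / 4)) ((m : ℝ) * (10 / 81)) (by positivity) (by
        intro i hi
        have hi0 : θ i = 0 := by simpa using hG₀sub hi
        refine (lint_gauss (θ i) v hv0 (2 / (5 * σ ^ 2)) (by positivity) _ (by fun_prop) ?_).trans ?_
        · intro x
          rw [hi0, hvR, ← Real.exp_add]
          apply Real.exp_le_exp.2
          apply le_of_eq
          field_simp
          ring
        · apply ENNReal.ofReal_le_ofReal
          apply Real.sqrt_le_sqrt
          rw [hvR]
          apply le_of_eq
          field_simp
          norm_num)
    rw [hG₀] at this
    rw [hPpi]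
    refine this.trans (le_of_eq ?_)
    rw [mul_pow, ← Real.exp_nat_mul]
    congr 3
    ring
  set S := {y | σ ≤ sigmahat d y ∧ sigmahat d y ≤ 10 * σ} with hS
  set A := {y : Fin d → ℝ | (m : ℝ) * (10 / 81) ≤ ∑ i ∈ G₀, ((1 / (10 * σ ^ 2)) * (y i) ^ 2)}
    with hA
  set F := (Finset.univ : Finset (Finset (Fin d))).filter (fun G => G.card = m) with hF
  set B : Finset (Fin d) → Set (Fin d → ℝ) :=
    fun G => {y | -((m : ℝ) / 2) ≤ ∑ i ∈ G, (-(81 / (2 * σ ^ 2)) * (y i) ^ 2)} with hB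
  have hcov : Sᶜ ⊆ A ∪ ⋃ G ∈ F, B G := by
    intro y hy
    by_contra hcon
    apply hy
    simp only [Set.mem_union, Set.mem_iUnion, not_or, not_exists, hF, hA, hB, Finset.mem_filter,
      Finset.mem_univ, true_and, Set.mem_setOf_eq, not_le, ← Finset.mul_sum] at hcon
    obtain ⟨h1, h2⟩ := hcon
    refine sigmahat_good (by omega) σ hσ y G₀ (by omega) ?_ ?_
    · intro G hG
      have := h2 G (by omega)
      rw [← hm]
      rw [neg_mul, neg_lt_neg_iff, div_mul_eq_mul_div, lt_div_iff₀ (by positivity)] at this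
      linarith
    · rw [← hm]
      rw [div_mul_eq_mul_div, div_lt_iff₀ (by positivity)] at h1
      linarith
  have hFc : (F.card : ℝ) ≤ 2 * 4 ^ m := by
    have h1 : F.card ≤ 2 ^ d := by
      calc F.card ≤ (Finset.univ : Finset (Finset (Fin d))).card := Finset.card_filter_le _ _
        _ = 2 ^ d := by simp
    have h2 : 2 ^ d ≤ 2 * 4 ^ m := by
      calc 2 ^ d ≤ 2 ^ (2 * m + 1) := Nat.pow_le_pow_right (by norm_num) (by omega)
        _ = 2 * 4 ^ m := by rw [pow_succ, pow_mul]; norm_num [mul_comm]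
    exact_mod_cast h1.trans h2
  have hbad : P Sᶜ ≤ ENNReal.ofReal (3 * (99 / 100) ^ m) := by
    calc P Sᶜ ≤ P A + ∑ G ∈ F, P (B G) :=
          (measure_mono hcov).trans ((measure_union_le _ _).trans
            (add_le_add le_rfl (measure_biUnion_finset_le _ _)))
      _ ≤ ENNReal.ofReal ((Real.exp (-(10 / 81)) * √(5 / 4)) ^ m) +
          ∑ G ∈ F, ENNReal.ofReal ((Real.exp (1 / 2) * (1 / 9)) ^ m) := by
          gcongr with G hG
          exact hlow G (by simpa [hF] using hG)
      _ = ENNReal.ofReal ((Real.exp (-(10 / 81)) * √(5 / 4)) ^ m +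
          F.card * (Real.exp (1 / 2) * (1 / 9)) ^ m) := by
          rw [Finset.sum_const, nsmul_eq_mul, ENNReal.ofReal_add (by positivity) (by positivity),
            ENNReal.ofReal_mul (by positivity), ENNReal.ofReal_natCast]
      _ ≤ _ := by
          apply ENNReal.ofReal_le_ofReal
          have e1 := pow_le_pow_left₀ (by positivity) num2 m
          have e2 := pow_le_pow_left₀ (by positivity) num1 m
          rw [mul_pow] at e2
          have e3 : (F.card : ℝ) * (Real.exp (1 / 2) * (1 / 9)) ^ m
              ≤ 2 * 4 ^ m * (Real.exp (1 / 2) * (1 / 9)) ^ m := by gcongr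
          linarith
  have hfin : 3 * (99 / 100 : ℝ) ^ m ≤ ((d : ℝ) ^ 5)⁻¹ := by
    have hdm : (d : ℝ) ≤ 3 * m := by
      have : d ≤ 3 * m := by omega
      exact_mod_cast this
    have hd0 : (0 : ℝ) < d := by
      have : 0 < d := by omega
      exact_mod_cast this
    have h1 : (d : ℝ) ^ 5 ≤ (3 * m) ^ 5 := pow_le_pow_left₀ hd0.le hdm 5
    have h2 := hM m hmM
    rw [le_inv_comm₀ (by positivity) (by positivity)]
    refine h1.trans ?_
    rw [le_inv_comm₀ (by positivity) (by positivity), ← one_div, le_div_iff₀ (by positivity)]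
    nlinarith
  have htot : 1 ≤ P S + P Sᶜ := by
    rw [← measure_univ (μ := P), ← Set.union_compl_self S]
    exact measure_union_le _ _
  rw [ENNReal.ofReal_sub _ (by positivity), ENNReal.ofReal_one]
  rw [tsub_le_iff_right]
  refine htot.trans (add_le_add le_rfl (hbad.trans (ENNReal.ofReal_le_ofReal hfin)))
end

section
/- There exist an absolute constant d0 ≥ 3 and an absolute constant C̄ > 0 such that for all integers d ≥ d0, all σ > 0 and all integers s with 1 ≤ s < d/2: sup_{θ ∈ Θ_s} E_θ[ σ̂⁴ ] ≤ C̄ σ⁴. -/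
open MeasureTheory ProbabilityTheory

lemma gauss_fourth_std_lt_top :
    ∫⁻ x, ENNReal.ofReal (x ^ 4) ∂(gaussianReal 0 1) < ⊤ := by
  have h := (memLp_id_gaussianReal (μ := 0) (v := 1) 4).integrable_norm_pow (p := 4) (by norm_num)
  have h2 : Integrable (fun x : ℝ => x ^ 4) (gaussianReal 0 1) := by
    refine h.congr (Filter.Eventually.of_forall fun x => ?_)
    simp only [id, Real.norm_eq_abs]
    exact Even.pow_abs (by decide) x
  exact h2.lintegral_lt_top

lemma gauss_fourth (σ : ℝ) :
    ∫⁻ x, ENNReal.ofReal (x ^ 4) ∂(gaussianReal 0 (Real.toNNReal (σ ^ 2)))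
      = ENNReal.ofReal (σ ^ 4) * ∫⁻ x, ENNReal.ofReal (x ^ 4) ∂(gaussianReal 0 1) := by
  have h : gaussianReal 0 (Real.toNNReal (σ ^ 2)) = (gaussianReal 0 1).map (σ * ·) := by
    rw [gaussianReal_map_const_mul]
    congr 1
    · simp
    · ext
      simp [Real.coe_toNNReal _ (sq_nonneg σ)]
  rw [h, lintegral_map (by fun_prop) (by fun_prop), ← lintegral_const_mul _ (by fun_prop)]
  congr 1
  ext x
  rw [← ENNReal.ofReal_mul (by positivity), mul_pow]

lemma sigmahat_le (d : ℕ) (hd : 2 ≤ d) (G : Finset (Fin d)) (hG : G.card = d / 2)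
    (y : Fin d → ℝ) :
    (sigmahat d y) ^ 4 ≤ 6561 * ((d / 2 : ℕ) : ℝ)⁻¹ * ∑ i ∈ G, (y i) ^ 4 := by
  unfold sigmahat
  set m : ℝ := ((d / 2 : ℕ) : ℝ) with hm
  have hm0 : 0 < m := by
    rw [hm]
    have : 0 < d / 2 := by omega
    exact_mod_cast this
  set S := sInf {x : ℝ | ∃ G : Finset (Fin d), G.card = d / 2 ∧ x = ∑ i ∈ G, (y i) ^ 2}
  have hS0 : 0 ≤ S := by
    apply Real.sInf_nonneg
    rintro x ⟨G, -, rfl⟩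
    positivity
  have hS1 : S ≤ ∑ i ∈ G, (y i) ^ 2 := by
    apply csInf_le
    · refine ⟨0, ?_⟩
      rintro x ⟨G, -, rfl⟩
      positivity
    · exact ⟨G, hG, rfl⟩
  have hcs : (∑ i ∈ G, (y i) ^ 2) ^ 2 ≤ m * ∑ i ∈ G, (y i) ^ 4 := by
    have := sq_sum_le_card_mul_sum_sq (s := G) (f := fun i => (y i) ^ 2)
    rw [hG] at this
    simpa [← pow_mul] using this
  have hsq : Real.sqrt (m⁻¹ * S) ^ 2 = m⁻¹ * S := Real.sq_sqrt (by positivity)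
  have h1 : S ^ 2 ≤ m * ∑ i ∈ G, (y i) ^ 4 :=
    (pow_le_pow_left₀ hS0 hS1 2).trans hcs
  calc (9 * Real.sqrt (m⁻¹ * S)) ^ 4 = 6561 * (Real.sqrt (m⁻¹ * S) ^ 2) ^ 2 := by ring
    _ = 6561 * m⁻¹ ^ 2 * S ^ 2 := by rw [hsq]; ring
    _ ≤ 6561 * m⁻¹ ^ 2 * (m * ∑ i ∈ G, (y i) ^ 4) := by gcongr
    _ = _ := by field_simp

/-- Proposition 2, eq. (11): the fourth moment of `σ̂` is bounded by `C̄ σ⁴`,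
uniformly over `Θ_s` for `s < d/2`. -/
theorem sigmahat_fourth_moment :
    ∃ d0 : ℕ, 3 ≤ d0 ∧ ∃ Cbar : ℝ, 0 < Cbar ∧
      ∀ d : ℕ, d0 ≤ d → ∀ σ : ℝ, 0 < σ → ∀ s : ℕ, 1 ≤ s → (s : ℝ) < (d : ℝ) / 2 →
        ∀ θ ∈ Theta d s,
          ∫⁻ y, ENNReal.ofReal ((sigmahat d y) ^ 4) ∂(gaussMeasure d θ σ)
            ≤ ENNReal.ofReal (Cbar * σ ^ 4) := by
  set K := ∫⁻ x, ENNReal.ofReal (x ^ 4) ∂(gaussianReal 0 1) with hK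
  have hKtop : K ≠ ⊤ := gauss_fourth_std_lt_top.ne
  refine ⟨3, le_rfl, 6561 * K.toReal + 1, by positivity, ?_⟩
  intro d hd σ hσ s hs hsd θ hθ
  have hsd' : 2 * s < d := by
    have : (2 * s : ℝ) < d := by linarith
    exact_mod_cast this
  have hcard : d / 2 ≤ (Finset.univ.filter fun j => θ j = 0).card := by
    have h1 : (Finset.univ.filter fun j => θ j ≠ 0).card ≤ s := by
      have h : {j | θ j ≠ 0}.ncard ≤ s := hθ
      rw [Set.ncard_eq_toFinset_card'] at h
      simpa [Set.toFinset_setOf] using h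
    have h2 := Finset.card_filter_add_card_filter_not (s := (Finset.univ : Finset (Fin d)))
      (fun j => θ j = 0)
    rw [Finset.card_univ, Fintype.card_fin] at h2
    simp only [ne_eq] at h1
    omega
  obtain ⟨G, hGsub, hG⟩ := Finset.exists_subset_card_eq hcard
  have hm0 : 0 < ((d / 2 : ℕ) : ℝ) := by
    have : 0 < d / 2 := by omega
    exact_mod_cast this
  have hint : ∀ i ∈ G, ∫⁻ y, ENNReal.ofReal ((y i) ^ 4) ∂(gaussMeasure d θ σ)
      = ENNReal.ofReal (σ ^ 4) * K := by
    intro i hi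
    have h0 : θ i = 0 := by simpa using hGsub hi
    have hmp := measurePreserving_eval
      (fun j => gaussianReal (θ j) (Real.toNNReal (σ ^ 2))) i
    have h := hmp.lintegral_comp (f := fun x : ℝ => ENNReal.ofReal (x ^ 4)) (by fun_prop)
    rw [h0, gauss_fourth] at h
    exact h
  calc ∫⁻ y, ENNReal.ofReal ((sigmahat d y) ^ 4) ∂(gaussMeasure d θ σ)
      ≤ ∫⁻ y, ENNReal.ofReal (6561 * ((d / 2 : ℕ) : ℝ)⁻¹) *
          ∑ i ∈ G, ENNReal.ofReal ((y i) ^ 4) ∂(gaussMeasure d θ σ) := by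
        refine lintegral_mono fun y => ?_
        rw [← ENNReal.ofReal_sum_of_nonneg (fun i _ => by positivity),
          ← ENNReal.ofReal_mul (by positivity)]
        exact ENNReal.ofReal_le_ofReal (sigmahat_le d (by omega) G hG y)
    _ = ENNReal.ofReal (6561 * ((d / 2 : ℕ) : ℝ)⁻¹) *
          ∑ i ∈ G, ENNReal.ofReal (σ ^ 4) * K := by
        rw [lintegral_const_mul _ (by fun_prop), lintegral_finsetSum _ (by fun_prop),
          Finset.sum_congr rfl hint]
    _ = ENNReal.ofReal (6561 * K.toReal * σ ^ 4) := by
        rw [Finset.sum_const, hG, nsmul_eq_mul, ← ENNReal.ofReal_natCast,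
          ← ENNReal.ofReal_toReal hKtop, ← ENNReal.ofReal_mul (by positivity),
          ← ENNReal.ofReal_mul (by positivity), ← ENNReal.ofReal_mul (by positivity),
          ENNReal.toReal_ofReal ENNReal.toReal_nonneg]
        congr 1
        field_simp
    _ ≤ _ := by
        apply ENNReal.ofReal_le_ofReal
        have : 0 < σ ^ 4 := by positivity
        nlinarith
end

section
/- For every α > 48 there is a constant c > 0 depending only on α such that for all d ≥ 3, all integers s with 1 ≤ s ≤ √(d log d/2), and all subsets U ⊆ {1,…,d}: P( sup_{t ∈ [1,10]} | ∑_{i ∈ U} ξ_i·1{|ξ_i| > √α · a · t} | > √α · s · a ) ≤ c d^{-6}, where a = √(log(1 + d(log d)/s²)) and ξ_1,…,ξ_d are i.i.d. standard normal random variables. -/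
open MeasureTheory ProbabilityTheory

lemma gauss_moment :
    ∫⁻ x : ℝ, ENNReal.ofReal (Real.exp (3 / 8 * x ^ 2)) ∂(gaussianReal 0 1) = ENNReal.ofReal 2 := by
  rw [gaussianReal_of_var_ne_zero _ one_ne_zero,
    lintegral_withDensity_eq_lintegral_mul _ (measurable_gaussianPDF 0 1) (by fun_prop)]
  have h : ∀ x : ℝ, (gaussianPDF 0 1 * fun x : ℝ => ENNReal.ofReal (Real.exp (3 / 8 * x ^ 2))) x
      = ENNReal.ofReal ((Real.sqrt (2 * Real.pi))⁻¹ * Real.exp (-(1 / 8) * x ^ 2)) := by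
    intro x
    simp only [Pi.mul_apply, gaussianPDF, gaussianPDFReal]
    rw [← ENNReal.ofReal_mul (by positivity)]
    congr 1
    rw [mul_assoc, ← Real.exp_add]
    simp only [NNReal.coe_one, mul_one, sub_zero]
    congr 2
    ring
  rw [lintegral_congr h, ← ofReal_integral_eq_lintegral_ofReal]
  · rw [integral_const_mul, integral_gaussian]
    congr 1
    rw [← Real.sqrt_inv, ← Real.sqrt_mul (by positivity)]
    rw [show (2 * Real.pi)⁻¹ * (Real.pi / (1 / 8)) = 2 ^ 2 by field_simp; norm_num]
    simp
  · exact (integrable_exp_neg_mul_sq (by norm_num)).const_mul _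
  · exact Filter.Eventually.of_forall fun x => by positivity

lemma gauss_tail (β γ T : ℝ) (hT : 0 ≤ T) (hγ : 0 ≤ γ) (h : β + γ = 3 / 8) :
    ∫⁻ x : ℝ, (if T < |x| then ENNReal.ofReal (Real.exp (β * x ^ 2)) else 0) ∂(gaussianReal 0 1)
      ≤ ENNReal.ofReal (2 * Real.exp (-γ * T ^ 2)) := by
  have h1 : ∀ x : ℝ, (if T < |x| then ENNReal.ofReal (Real.exp (β * x ^ 2)) else 0) ≤
      ENNReal.ofReal (Real.exp (-γ * T ^ 2)) * ENNReal.ofReal (Real.exp (3 / 8 * x ^ 2)) := by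
    intro x
    split_ifs with hx
    · rw [← ENNReal.ofReal_mul (by positivity), ← Real.exp_add]
      apply ENNReal.ofReal_le_ofReal
      apply Real.exp_le_exp.mpr
      have : T ^ 2 ≤ x ^ 2 := by rw [← sq_abs x]; gcongr
      rw [← h]
      nlinarith
    · exact zero_le
  refine (lintegral_mono h1).trans ?_
  rw [lintegral_const_mul _ (by fun_prop), gauss_moment, ← ENNReal.ofReal_mul (by positivity), mul_comm]

lemma tail_set (T : ℝ) (hT : 0 ≤ T) :
    gaussianReal 0 1 {x : ℝ | T < |x|} ≤ ENNReal.ofReal (2 * Real.exp (-(3 / 8) * T ^ 2)) := by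
  have h := gauss_tail 0 (3 / 8) T hT (by norm_num) (by norm_num)
  refine le_trans (le_of_eq ?_) h
  have hm : MeasurableSet {x : ℝ | T < |x|} := measurableSet_lt (by fun_prop) (by fun_prop)
  rw [← lintegral_indicator_one hm]
  refine lintegral_congr fun x => ?_
  simp [Set.indicator_apply]

lemma mgf_trunc (T : ℝ) (hT : 0 ≤ T) :
    ∫⁻ x : ℝ, ENNReal.ofReal (Real.exp ((if T < |x| then x ^ 2 else 0) / 4)) ∂(gaussianReal 0 1)
      ≤ ENNReal.ofReal (Real.exp (2 * Real.exp (-(1 / 8) * T ^ 2))) := by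
  have h := gauss_tail (1 / 4) (1 / 8) T hT (by norm_num) (by norm_num)
  have h1 : ∀ x : ℝ, ENNReal.ofReal (Real.exp ((if T < |x| then x ^ 2 else 0) / 4)) ≤
      1 + (if T < |x| then ENNReal.ofReal (Real.exp (1 / 4 * x ^ 2)) else 0) := by
    intro x
    split_ifs
    · rw [show x ^ 2 / 4 = 1 / 4 * x ^ 2 by ring]; exact le_add_self
    · simp
  refine (lintegral_mono h1).trans ?_
  rw [lintegral_add_left measurable_const]
  simp only [lintegral_const, measure_univ, mul_one]
  refine (add_le_add_right h 1).trans ?_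
  rw [← ENNReal.ofReal_one, ← ENNReal.ofReal_add (by norm_num) (by positivity)]
  apply ENNReal.ofReal_le_ofReal
  rw [add_comm]
  exact Real.add_one_le_exp _

/-- truncated energy -/
noncomputable def truncW {d : ℕ} (T : ℝ) (ξ : Fin d → ℝ) : ℝ :=
  ∑ i, if T < |ξ i| then ξ i ^ 2 else 0

lemma measurable_trunc (T : ℝ) : Measurable fun x : ℝ => if T < |x| then x ^ 2 else 0 :=
  Measurable.ite (measurableSet_lt (by fun_prop) (by fun_prop)) (by fun_prop) (by fun_prop)

lemma measurable_truncW {d : ℕ} (T : ℝ) : Measurable (truncW (d := d) T) := by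
  unfold truncW
  exact Finset.measurable_sum _ fun i _ => (measurable_trunc T).comp (measurable_pi_apply i)

lemma truncW_tail (d : ℕ) (T m : ℝ) (hT : 0 ≤ T) :
    (Measure.pi fun _ : Fin d => gaussianReal 0 1) {ξ | m < truncW T ξ} ≤
      ENNReal.ofReal (Real.exp (-m / 4 + d * (2 * Real.exp (-(1 / 8) * T ^ 2)))) := by
  have h1 : ∀ ξ : Fin d → ℝ, ENNReal.ofReal (Real.exp (truncW T ξ / 4)) =
      ∏ i, ENNReal.ofReal (Real.exp ((if T < |ξ i| then ξ i ^ 2 else 0) / 4)) := by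
    intro ξ
    rw [← ENNReal.ofReal_prod_of_nonneg (fun i _ => by positivity), ← Real.exp_sum, truncW,
      Finset.sum_div]
  have hg : Measurable fun x : ℝ =>
      ENNReal.ofReal (Real.exp ((if T < |x| then x ^ 2 else 0) / 4)) := by
    have := measurable_trunc T
    fun_prop
  have h2 : ∫⁻ ξ : Fin d → ℝ, ENNReal.ofReal (Real.exp (truncW T ξ / 4))
      ∂(Measure.pi fun _ : Fin d => gaussianReal 0 1) ≤
      ENNReal.ofReal (Real.exp (d * (2 * Real.exp (-(1 / 8) * T ^ 2)))) := by
    simp_rw [h1]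
    have hind := iIndepFun_pi (μ := fun _ : Fin d => gaussianReal 0 1) (X := fun _ x =>
      ENNReal.ofReal (Real.exp ((if T < |x| then x ^ 2 else 0) / 4))) (fun _ => hg.aemeasurable)
    rw [lintegral_prod_eq_prod_lintegral_of_indepFun Finset.univ _ hind
      (fun i => hg.comp (measurable_pi_apply i))]
    have hev : ∀ i : Fin d, ∫⁻ ω : Fin d → ℝ, ENNReal.ofReal (Real.exp
        ((if T < |ω i| then ω i ^ 2 else 0) / 4)) ∂(Measure.pi fun _ : Fin d => gaussianReal 0 1) ≤
        ENNReal.ofReal (Real.exp (2 * Real.exp (-(1 / 8) * T ^ 2))) := by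
      intro i
      refine le_trans (le_of_eq ?_) (mgf_trunc T hT)
      exact (measurePreserving_eval (fun _ : Fin d => gaussianReal 0 1) i).lintegral_comp hg
    refine (Finset.prod_le_prod' fun i _ => hev i).trans ?_
    rw [Finset.prod_const, Finset.card_univ, Fintype.card_fin,
      ← ENNReal.ofReal_pow (by positivity), ← Real.exp_nat_mul]
  have h3 := mul_meas_ge_le_lintegral (μ := Measure.pi fun _ : Fin d => gaussianReal 0 1)
    (f := fun ξ => ENNReal.ofReal (Real.exp (truncW T ξ / 4)))
    (by have := measurable_truncW (d := d) T; fun_prop) (ENNReal.ofReal (Real.exp (m / 4)))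
  have h4 : (Measure.pi fun _ : Fin d => gaussianReal 0 1) {ξ | m < truncW T ξ} ≤
    (Measure.pi fun _ : Fin d => gaussianReal 0 1) {ξ | ENNReal.ofReal (Real.exp (m / 4)) ≤
      ENNReal.ofReal (Real.exp (truncW T ξ / 4))} := by
    apply measure_mono
    intro ξ hξ
    simp only [Set.mem_ofPred_eq] at hξ ⊢
    gcongr
  have h5 : (Measure.pi fun _ : Fin d => gaussianReal 0 1) {ξ | m < truncW T ξ} =
     ENNReal.ofReal (Real.exp (-m / 4)) * (ENNReal.ofReal (Real.exp (m / 4)) *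
     (Measure.pi fun _ : Fin d => gaussianReal 0 1) {ξ | m < truncW T ξ}) := by
    rw [← mul_assoc, ← ENNReal.ofReal_mul (by positivity), ← Real.exp_add]
    rw [show -m / 4 + m / 4 = 0 by ring]; simp
  rw [h5, Real.exp_add, ENNReal.ofReal_mul (by positivity)]
  gcongr
  exact (mul_le_mul_right h4 _).trans (h3.trans h2)

lemma truncW_pos (d : ℕ) (T m : ℝ) (hT : 0 ≤ T) (hm : 0 ≤ m) :
    (Measure.pi fun _ : Fin d => gaussianReal 0 1) {ξ | m < truncW T ξ} ≤
      ENNReal.ofReal (d * (2 * Real.exp (-(3 / 8) * T ^ 2))) := by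
  have hsub : {ξ : Fin d → ℝ | m < truncW T ξ} ⊆
      ⋃ i : Fin d, (fun ξ : Fin d → ℝ => ξ i) ⁻¹' {x : ℝ | T < |x|} := by
    intro ξ hξ
    by_contra hc
    simp only [Set.mem_iUnion, Set.mem_preimage, Set.mem_ofPred_eq, not_exists] at hc hξ
    have : truncW T ξ = 0 := Finset.sum_eq_zero fun i _ => if_neg (hc i)
    linarith
  refine (measure_mono hsub).trans ((measure_iUnion_fintype_le _ _).trans ?_)
  have hme : MeasurableSet {x : ℝ | T < |x|} := measurableSet_lt (by fun_prop) (by fun_prop)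
  have : ∀ i : Fin d, (Measure.pi fun _ : Fin d => gaussianReal 0 1)
      ((fun ξ : Fin d → ℝ => ξ i) ⁻¹' {x : ℝ | T < |x|}) ≤
      ENNReal.ofReal (2 * Real.exp (-(3 / 8) * T ^ 2)) := by
    intro i
    have := (measurePreserving_eval (fun _ : Fin d => gaussianReal 0 1) i).measure_preimage
      hme.nullMeasurableSet
    refine le_trans (le_of_eq this) (tail_set T hT)
  refine (Finset.sum_le_sum fun i _ => this i).trans ?_
  rw [Finset.sum_const, Finset.card_univ, Fintype.card_fin, nsmul_eq_mul,
    ENNReal.ofReal_mul (by positivity) (p := (d : ℝ)), ENNReal.ofReal_natCast]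

/-- sign of a boolean -/
noncomputable def bsgn (b : Bool) : ℝ := if b then 1 else -1

lemma abs_bsgn_mul (b : Bool) (x : ℝ) : |bsgn b * x| = |x| := by
  cases b <;> simp [bsgn]

lemma flip_pres {d : ℕ} (ε : Fin d → Bool) :
    MeasurePreserving (fun (ξ : Fin d → ℝ) i => bsgn (ε i) * ξ i)
      (Measure.pi fun _ : Fin d => gaussianReal 0 1)
      (Measure.pi fun _ : Fin d => gaussianReal 0 1) := by
  apply measurePreserving_pi (fun _ : Fin d => gaussianReal 0 1) (fun _ : Fin d => gaussianReal 0 1)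
    (f := fun i x => bsgn (ε i) * x)
  intro i
  refine ⟨by fun_prop, ?_⟩
  cases ε i
  · simp only [bsgn]
    have := gaussianReal_map_neg (μ := 0) (v := 1)
    simpa using this
  · simp [bsgn]

open Classical in
lemma sym_bound {d : ℕ} (E : Set (Fin d → ℝ)) (hE : MeasurableSet E) (K : ℝ) (hK : 0 ≤ K)
    (h : ∀ ξ : Fin d → ℝ, ((Finset.univ.filter fun ε : Fin d → Bool =>
      (fun i => bsgn (ε i) * ξ i) ∈ E).card : ℝ) ≤ 2 ^ d * K) :
    (Measure.pi fun _ : Fin d => gaussianReal 0 1) E ≤ ENNReal.ofReal K := by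
  set μ := (Measure.pi fun _ : Fin d => gaussianReal 0 1)
  have h1 : ∀ ε : Fin d → Bool, μ E = ∫⁻ ξ, E.indicator 1 (fun i => bsgn (ε i) * ξ i) ∂μ := by
    intro ε
    rw [← lintegral_indicator_one hE]
    exact ((flip_pres ε).lintegral_comp (measurable_one.indicator hE)).symm
  have h2 : (2 ^ d : ENNReal) * μ E =
      ∫⁻ ξ, ∑ ε : Fin d → Bool, E.indicator 1 (fun i => bsgn (ε i) * ξ i) ∂μ := by
    rw [lintegral_finsetSum]
    · rw [← Finset.sum_congr rfl fun ε _ => h1 ε]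
      simp
    · intro ε _
      exact (measurable_one.indicator hE).comp (flip_pres ε).measurable
  have h3 : (2 ^ d : ENNReal) * μ E ≤ 2 ^ d * ENNReal.ofReal K := by
    rw [h2]
    have : ∀ ξ : Fin d → ℝ, ∑ ε : Fin d → Bool, E.indicator (1 : (Fin d → ℝ) → ENNReal)
        (fun i => bsgn (ε i) * ξ i) ≤ ENNReal.ofReal (2 ^ d * K) := by
      intro ξ
      refine le_trans (le_of_eq ?_) (ENNReal.ofReal_le_ofReal (h ξ))
      simp [Set.indicator_apply]
    refine (lintegral_mono this).trans ?_
    simp [ENNReal.ofReal_mul, μ]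
  exact (ENNReal.mul_le_mul_iff_right (by simp) (by finiteness)).mp h3

lemma sum_exp_sign {d : ℕ} (r : Fin d → ℝ) :
    ∑ ε : Fin d → Bool, Real.exp (∑ i, bsgn (ε i) * r i) ≤
      2 ^ d * Real.exp ((∑ i, r i ^ 2) / 2) := by
  have : ∑ ε : Fin d → Bool, Real.exp (∑ i, bsgn (ε i) * r i) =
      ∏ i, ∑ b : Bool, Real.exp (bsgn b * r i) := by
    simp_rw [Real.exp_sum]
    rw [Finset.prod_univ_sum, Fintype.piFinset_univ]
  rw [this, Finset.sum_div, Real.exp_sum]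
  calc _ ≤ ∏ i, (2 * Real.exp (r i ^ 2 / 2)) := by
        apply Finset.prod_le_prod
        · intro i _; positivity
        · intro i _
          have := Real.cosh_le_exp_half_sq (r i)
          rw [Real.cosh_eq] at this
          simp [bsgn]
          linarith
    _ = _ := by simp [Finset.prod_mul_distrib]

open Classical in
lemma hoeff {d : ℕ} (r : Fin d → ℝ) (m l : ℝ) (hm : 0 < m) (hl : 0 < l) (h : ∑ i, r i ^ 2 ≤ m) :
    ((Finset.univ.filter fun ε : Fin d → Bool => l < |∑ i, bsgn (ε i) * r i|).card : ℝ) ≤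
      2 ^ d * (2 * Real.exp (-l ^ 2 / (2 * m))) := by
  have key : ∀ θ : ℝ, θ ^ 2 = (l / m) ^ 2 →
      ∑ ε : Fin d → Bool, Real.exp (θ * ∑ i, bsgn (ε i) * r i) ≤
      2 ^ d * Real.exp (l ^ 2 / (2 * m)) := by
    intro θ hθ
    have h1 := sum_exp_sign fun i => θ * r i
    have h2 : ∀ ε : Fin d → Bool, θ * ∑ i, bsgn (ε i) * r i = ∑ i, bsgn (ε i) * (θ * r i) := by
      intro ε
      rw [Finset.mul_sum]
      exact Finset.sum_congr rfl fun i _ => by ring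
    simp_rw [h2]
    refine h1.trans ?_
    refine mul_le_mul_of_nonneg_left (Real.exp_le_exp.mpr ?_) (by positivity)
    simp_rw [mul_pow, hθ]
    rw [← Finset.mul_sum]
    have e : l ^ 2 / (2 * m) = (l / m) ^ 2 * m / 2 := by field_simp
    rw [e]
    gcongr
  have k1 := key (l / m) rfl
  have k2 := key (-(l / m)) (by ring)
  have h3 : ((Finset.univ.filter fun ε : Fin d → Bool => l < |∑ i, bsgn (ε i) * r i|).card : ℝ)
      * Real.exp (l ^ 2 / m) ≤ ∑ ε : Fin d → Bool, (Real.exp ((l / m) * ∑ i, bsgn (ε i) * r i)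
        + Real.exp (-(l / m) * ∑ i, bsgn (ε i) * r i)) := by
    rw [← nsmul_eq_mul, ← Finset.sum_const]
    refine (Finset.sum_le_sum ?_).trans
      (Finset.sum_le_sum_of_subset_of_nonneg (Finset.filter_subset _ _) ?_)
    · intro ε hε
      simp only [Finset.mem_filter, Finset.mem_univ, true_and] at hε
      rw [show l ^ 2 / m = l / m * l by ring]
      have hp : 0 < l / m := by positivity
      rcases lt_abs.mp hε with h | h
      · have : Real.exp (l / m * l) ≤ Real.exp ((l / m) * ∑ i, bsgn (ε i) * r i) := by gcongr
        have := Real.exp_pos (-(l / m) * ∑ i, bsgn (ε i) * r i)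
        linarith
      · have : Real.exp (l / m * l) ≤ Real.exp (-(l / m) * ∑ i, bsgn (ε i) * r i) := by
          rw [neg_mul_comm]; gcongr
        have := Real.exp_pos ((l / m) * ∑ i, bsgn (ε i) * r i)
        linarith
    · intros; positivity
  rw [Finset.sum_add_distrib] at h3
  have h4 : Real.exp (-l ^ 2 / (2 * m)) * Real.exp (l ^ 2 / m) = Real.exp (l ^ 2 / (2 * m)) := by
    rw [← Real.exp_add]; congr 1; field_simp; ring
  refine le_of_mul_le_mul_right ?_ (Real.exp_pos (l ^ 2 / m))
  calc _ ≤ _ := h3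
    _ ≤ 2 ^ d * (2 * Real.exp (l ^ 2 / (2 * m))) := by linarith
    _ = _ := by rw [← h4]; ring

open Classical in
lemma Ej_bound {d : ℕ} (U : Finset (Fin d)) (T m l : ℝ) (hm : 0 < m) (hl : 0 < l) (j : Fin d) :
    (Measure.pi fun _ : Fin d => gaussianReal 0 1)
      {ξ | (T < |ξ j| ∧ truncW T ξ ≤ m) ∧ l < |∑ i ∈ U, if |ξ j| ≤ |ξ i| then ξ i else 0|} ≤
      ENNReal.ofReal (2 * Real.exp (-l ^ 2 / (2 * m))) := by
  apply sym_bound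
  · have : Measurable fun ξ : Fin d → ℝ => ∑ i ∈ U, if |ξ j| ≤ |ξ i| then ξ i else 0 :=
      Finset.measurable_sum _ fun i _ =>
        Measurable.ite (measurableSet_le (by fun_prop) (by fun_prop)) (by fun_prop) (by fun_prop)
    have m1 : MeasurableSet {ξ : Fin d → ℝ | T < |ξ j|} :=
      measurableSet_lt (by fun_prop) (by fun_prop)
    have m2 : MeasurableSet {ξ : Fin d → ℝ | truncW T ξ ≤ m} :=
      measurableSet_le (measurable_truncW T) (by fun_prop)
    exact (m1.inter m2).inter (measurableSet_lt measurable_const this.abs)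
  · positivity
  intro ξ
  by_cases hc : T < |ξ j| ∧ truncW T ξ ≤ m
  swap
  · rw [Finset.card_eq_zero.mpr]
    · simp only [Nat.cast_zero]; positivity
    · refine Finset.eq_empty_of_forall_notMem fun ε hε => ?_
      simp only [Finset.mem_filter] at hε
      replace hε := hε.2
      apply hc
      have := hε.1
      simp only [truncW, abs_bsgn_mul] at this ⊢
      refine ⟨this.1, le_trans (le_of_eq ?_) this.2⟩
      refine Finset.sum_congr rfl fun i _ => ?_
      rw [← sq_abs (bsgn _ * _), abs_bsgn_mul, sq_abs]
  set r : Fin d → ℝ := fun i => if i ∈ U then (if |ξ j| ≤ |ξ i| then ξ i else 0) else 0 with hr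
  have hs : ∑ i, r i ^ 2 ≤ m := by
    refine le_trans (Finset.sum_le_sum fun i _ => ?_) hc.2
    simp only [hr]
    split_ifs <;> first | (exfalso; linarith [hc.1]) | nlinarith [sq_nonneg (ξ i)]
  refine le_trans ?_ (hoeff r m l hm hl hs)
  norm_cast
  apply Finset.card_le_card
  intro ε hε
  simp only [Finset.mem_filter, Finset.mem_univ, true_and] at hε ⊢
  refine hε.2.trans_le (le_of_eq ?_)
  congr 1
  simp only [abs_bsgn_mul, hr, mul_ite, mul_zero]
  simp

lemma prob_bound {d : ℕ} (U : Finset (Fin d)) (T m l : ℝ) (hT : 0 ≤ T) (hm : 0 < m) (hl : 0 < l) :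
    (Measure.pi fun _ : Fin d => gaussianReal 0 1)
      {ξ | l < ⨆ t ∈ Set.Icc (1 : ℝ) 10, |∑ i ∈ U, if T * t < |ξ i| then ξ i else 0|} ≤
      (Measure.pi fun _ : Fin d => gaussianReal 0 1) {ξ | m < truncW T ξ} +
      ENNReal.ofReal (d * (2 * Real.exp (-l ^ 2 / (2 * m)))) := by
  have hsub : {ξ : Fin d → ℝ | l < ⨆ t ∈ Set.Icc (1 : ℝ) 10,
      |∑ i ∈ U, if T * t < |ξ i| then ξ i else 0|} ⊆
      {ξ | m < truncW T ξ} ∪ ⋃ j : Fin d, {ξ | (T < |ξ j| ∧ truncW T ξ ≤ m) ∧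
        l < |∑ i ∈ U, if |ξ j| ≤ |ξ i| then ξ i else 0|} := by
    intro ξ hξ
    by_cases hW : m < truncW T ξ
    · exact Or.inl hW
    right
    have hex : ∃ t ∈ Set.Icc (1 : ℝ) 10, l < |∑ i ∈ U, if T * t < |ξ i| then ξ i else 0| := by
      by_contra hc
      push Not at hc
      rw [Set.mem_ofPred_eq] at hξ
      refine absurd hξ (not_lt.mpr ?_)
      refine Real.iSup_le (fun t => Real.iSup_le (fun ht => hc t ht) hl.le) hl.le
    obtain ⟨t, ht, hlt⟩ := hex
    have hne : (U.filter fun i => T * t < |ξ i|).Nonempty := by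
      by_contra hc
      rw [Finset.not_nonempty_iff_eq_empty] at hc
      rw [← Finset.sum_filter, hc] at hlt
      simp at hlt
      linarith
    obtain ⟨j, hj, hmin⟩ := Finset.exists_min_image _ (fun i => |ξ i|) hne
    simp only [Finset.mem_filter] at hj hmin
    refine Set.mem_iUnion.mpr ⟨j, ⟨?_, not_lt.mp hW⟩, ?_⟩
    · have : T * 1 ≤ T * t := by gcongr; exact ht.1
      linarith [hj.2]
    · refine hlt.trans_le (le_of_eq ?_)
      congr 1
      refine Finset.sum_congr rfl fun i hi => ?_
      have : T * t < |ξ i| ↔ |ξ j| ≤ |ξ i| :=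
        ⟨fun h => hmin i ⟨hi, h⟩, fun h => hj.2.trans_le h⟩
      simp only [this]
  refine (measure_mono hsub).trans ((measure_union_le _ _).trans ?_)
  gcongr
  refine (measure_iUnion_fintype_le _ _).trans
    ((Finset.sum_le_sum fun j _ => Ej_bound U T m l hm hl j).trans ?_)
  rw [Finset.sum_const, Finset.card_univ, Fintype.card_fin, nsmul_eq_mul,
    ENNReal.ofReal_mul (by positivity) (p := (d : ℝ)), ENNReal.ofReal_natCast]

theorem truncated_gaussian_sup_bound :
    ∀ α : ℝ, 48 < α → ∃ c : ℝ, 0 < c ∧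
      ∀ d : ℕ, 3 ≤ d →
        ∀ s : ℕ, 1 ≤ s → (s : ℝ) ≤ Real.sqrt ((d : ℝ) * Real.log d / 2) →
          ∀ U : Finset (Fin d),
            (Measure.pi fun _ : Fin d => gaussianReal 0 1)
                {ξ : Fin d → ℝ |
                  Real.sqrt α * (s : ℝ) *
                      Real.sqrt (Real.log (1 + (d : ℝ) * Real.log d / (s : ℝ) ^ 2)) <
                    ⨆ t ∈ Set.Icc (1 : ℝ) 10,
                      |∑ i ∈ U,
                        if Real.sqrt α *
                            Real.sqrt (Real.log (1 + (d : ℝ) * Real.log d / (s : ℝ) ^ 2)) * t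
                            < |ξ i|
                        then ξ i else 0|}
              ≤ ENNReal.ofReal (c / (d : ℝ) ^ 6) := by
  intro α hα
  have hfac : (0 : ℝ) < 2 ^ 12 * (Nat.factorial 12 : ℝ) := by positivity
  refine ⟨2 ^ 12 * (Nat.factorial 12 : ℝ) + 2 + 2, by positivity, ?_⟩
  intro d hd s hs hsd U
  have hd3 : (3 : ℝ) ≤ d := by exact_mod_cast hd
  have hs1 : (1 : ℝ) ≤ s := by exact_mod_cast hs
  have hlog3 : 1 ≤ Real.log 3 := by
    rw [Real.le_log_iff_exp_le (by norm_num)]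
    linarith [Real.exp_one_lt_d9]
  have hlogd : 1 ≤ Real.log d := hlog3.trans (Real.log_le_log (by norm_num) hd3)
  set x : ℝ := (d : ℝ) * Real.log d / (s : ℝ) ^ 2 with hx
  have hx2 : 2 ≤ x := by
    have h1 := Real.le_sqrt' (by linarith) |>.mp hsd
    rw [hx, le_div_iff₀ (by positivity)]
    linarith
  set L := Real.log (1 + x) with hL
  have hL1 : 1 ≤ L := hlog3.trans (Real.log_le_log (by norm_num) (by linarith))
  have hexpL : Real.exp L = 1 + x := Real.exp_log (by linarith)
  set T := Real.sqrt α * Real.sqrt L with hT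
  have hα0 : 0 < α := by linarith
  have hT0 : 0 < T := by positivity
  have hT2 : T ^ 2 = α * L := by
    rw [hT, mul_pow, Real.sq_sqrt hα0.le, Real.sq_sqrt (by linarith)]
  have hT48 : 48 * L ≤ T ^ 2 := by rw [hT2]; nlinarith
  rw [show Real.sqrt α * (s : ℝ) * Real.sqrt L = s * T by rw [hT]; ring]
  set m : ℝ := (s * T) ^ 2 / (14 * Real.log d) with hm
  have hlogp : 0 < Real.log d := by linarith
  have hm0 : 0 < m := by positivity
  have hl0 : 0 < s * T := by positivity
  refine (prob_bound U T m (s * T) hT0.le hm0 hl0).trans ?_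
  have hA : (d : ℝ) * (2 * Real.exp (-(s * T) ^ 2 / (2 * m))) = 2 / (d : ℝ) ^ 6 := by
    have : -(s * T) ^ 2 / (2 * m) = -(7 * Real.log d) := by
      rw [hm]; field_simp; norm_num
    rw [this, Real.exp_neg, show (7 : ℝ) * Real.log d = ((7 : ℕ) : ℝ) * Real.log d by norm_num,
      Real.exp_nat_mul, Real.exp_log (by linarith)]
    field_simp
  have hB : (Measure.pi fun _ : Fin d => gaussianReal 0 1) {ξ | m < truncW T ξ} ≤
      ENNReal.ofReal ((2 ^ 12 * (Nat.factorial 12 : ℝ) + 2) / (d : ℝ) ^ 6) := by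
    rcases le_total (Real.sqrt d) x with hcase | hcase
    · refine (truncW_pos d T m hT0.le hm0.le).trans (ENNReal.ofReal_le_ofReal ?_)
      have h1 : Real.exp (-(3 / 8) * T ^ 2) ≤ ((d : ℝ) ^ 9)⁻¹ := by
        calc Real.exp (-(3 / 8) * T ^ 2) ≤ Real.exp (-(((18 : ℕ) : ℝ) * L)) := by
              apply Real.exp_le_exp.mpr; push_cast; linarith
          _ = ((1 + x) ^ 18)⁻¹ := by rw [Real.exp_neg, Real.exp_nat_mul, hexpL]
          _ ≤ (Real.sqrt d ^ 18)⁻¹ := by gcongr; linarith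
          _ = _ := by
            rw [show 18 = 2 * 9 by norm_num, pow_mul, Real.sq_sqrt (by linarith)]
      calc (d : ℝ) * (2 * Real.exp (-(3 / 8) * T ^ 2)) ≤ d * (2 * ((d : ℝ) ^ 9)⁻¹) := by gcongr
        _ = 2 / (d : ℝ) ^ 8 := by field_simp
        _ ≤ 2 / (d : ℝ) ^ 6 := by gcongr <;> first | linarith | norm_num
        _ ≤ _ := by gcongr; linarith
    · refine (truncW_tail d T m hT0.le).trans (ENNReal.ofReal_le_ofReal ?_)
      have hxd : Real.sqrt d ≤ d / x := by
        rw [le_div_iff₀ (by linarith)]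
        calc Real.sqrt d * x ≤ Real.sqrt d * Real.sqrt d := by gcongr
          _ = d := Real.mul_self_sqrt (by linarith)
      have hm4 : 6 / 7 * (d / x) ≤ m / 4 := by
        have : m / 4 = T ^ 2 / 56 * (d / x) := by
          rw [hm, hx]; field_simp; norm_num
        rw [this]
        refine mul_le_mul_of_nonneg_right ?_ (by positivity)
        linarith
      have h1 : Real.exp (-(1 / 8) * T ^ 2) ≤ 1 / 243 * (1 / x) := by
        calc Real.exp (-(1 / 8) * T ^ 2) ≤ Real.exp (-(((6 : ℕ) : ℝ) * L)) := by
              apply Real.exp_le_exp.mpr; push_cast; linarith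
          _ = ((1 + x) ^ 6)⁻¹ := by rw [Real.exp_neg, Real.exp_nat_mul, hexpL]
          _ ≤ (3 ^ 5 * x)⁻¹ := by
            gcongr
            rw [show (1 + x) ^ 6 = (1 + x) ^ 5 * (1 + x) by ring]
            gcongr <;> linarith
          _ = _ := by rw [mul_inv]; norm_num
      have h2 : (d : ℝ) * (2 * Real.exp (-(1 / 8) * T ^ 2)) ≤ 2 / 243 * (d / x) := by
        calc (d : ℝ) * (2 * Real.exp (-(1 / 8) * T ^ 2)) ≤ d * (2 * (1 / 243 * (1 / x))) := by
              gcongr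
          _ = _ := by ring
      have hdx : 0 < d / x := by positivity
      have h3 : -m / 4 + d * (2 * Real.exp (-(1 / 8) * T ^ 2)) ≤ -(Real.sqrt d / 2) := by
        have : -m / 4 = -(m / 4) := by ring
        linarith
      have h4 := Real.pow_div_factorial_le_exp (Real.sqrt d / 2) (by positivity) 12
      have h5 : (Real.sqrt d / 2) ^ 12 = (d : ℝ) ^ 6 / 2 ^ 12 := by
        rw [div_pow, show 12 = 2 * 6 by norm_num, pow_mul, Real.sq_sqrt (by linarith)]
      rw [h5] at h4
      calc _ ≤ Real.exp (-(Real.sqrt d / 2)) := Real.exp_le_exp.mpr h3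
        _ = (Real.exp (Real.sqrt d / 2))⁻¹ := Real.exp_neg _
        _ ≤ ((d : ℝ) ^ 6 / 2 ^ 12 / (Nat.factorial 12 : ℝ))⁻¹ := by gcongr
        _ = (2 ^ 12 * (Nat.factorial 12 : ℝ)) / (d : ℝ) ^ 6 := by field_simp
        _ ≤ _ := by gcongr; linarith
  rw [hA]
  refine (add_le_add_left hB _).trans ?_
  rw [← ENNReal.ofReal_add (by positivity) (by positivity), ← add_div]
end
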